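/- The group Γ₀ = ker ℓ₀ ≤ A_{G₀} is isomorphic to the trivial HNN extension of A_L over Γ_L, i.e. to HNNExtension A_L Γ_L Γ_L (MulEquiv.refl Γ_L), the group ⟨A_L, t ∣ t·c·t⁻¹ = c for all c ∈ Γ_L⟩, where Γ_L = ker ℓ is the kernel of the length homomorphism ℓ : A_L → ℤ. -/

import Mathlib

/-- The relator set of the right-angled Artin group of a simple graph `G`:
commutators of pairs of adjacent vertices. -/
def raagRels {V : Type*} (G : SimpleGraph V) : Set (FreeGroup V) :=
  {r | ∃ u v : V, G.Adj u v ∧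
    r = FreeGroup.of u * FreeGroup.of v * (FreeGroup.of u)⁻¹ * (FreeGroup.of v)⁻¹}

/-- The right-angled Artin group of a simple graph `G`. -/
abbrev RAAG {V : Type*} (G : SimpleGraph V) : Type _ :=
  PresentedGroup (raagRels G)

/-- The image `v̄` of a vertex (generator) `v` in the right-angled Artin group. -/
def RAAG.gen {V : Type*} (G : SimpleGraph V) (v : V) : RAAG G :=
  PresentedGroup.of (rels := raagRels G) v

/-- The path graph `L` on the four vertices `u₁ = 0, u₂ = 1, u₃ = 2, u₄ = 3`,
with edges `{u₁,u₂}, {u₂,u₃}, {u₃,u₄}`. -/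
abbrev L : SimpleGraph (Fin 4) := SimpleGraph.pathGraph 4

/-- The right-angled Artin group
`A_L = ⟨u₁,u₂,u₃,u₄ ∣ [u₁,u₂] = [u₂,u₃] = [u₃,u₄] = 1⟩`. -/
abbrev A_L : Type _ := RAAG L

/-- `a = ū₂⁻¹ū₁`. -/
def elt_a : A_L := (RAAG.gen L 1)⁻¹ * RAAG.gen L 0

/-- `x = ū₂⁻¹ū₃`. -/
def elt_x : A_L := (RAAG.gen L 1)⁻¹ * RAAG.gen L 2

/-- `e = ū₃⁻¹ū₄`. -/
def elt_e : A_L := (RAAG.gen L 2)⁻¹ * RAAG.gen L 3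

/-- The homomorphism `φ : FreeGroup (Fin 3) →* A_L` with `φ g₀ = a`, `φ g₁ = x`,
`φ g₂ = e`. -/
def phi : FreeGroup (Fin 3) →* A_L := FreeGroup.lift ![elt_a, elt_x, elt_e]

/-- The graph `G₀` on six vertices `u₁ = 0, u₂ = 1, u₃ = 2, u₄ = 3, p = 4, q = 5`:
the 1-skeleton of the suspension of the path `L`.  Its edges are
`{u₁,u₂}, {u₂,u₃}, {u₃,u₄}` together with `{p,uᵢ}` and `{q,uᵢ}` for `i = 1,2,3,4`. -/
def G₀ : SimpleGraph (Fin 6) := SimpleGraph.fromRel (fun i j =>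
  (i = 0 ∧ j = 1) ∨ (i = 1 ∧ j = 2) ∨ (i = 2 ∧ j = 3) ∨
  ((i = 4 ∨ i = 5) ∧ (j = 0 ∨ j = 1 ∨ j = 2 ∨ j = 3)))

open Multiplicative

theorem raag_comm {V : Type*} (G : SimpleGraph V) {u v : V} (h : G.Adj u v) :
    Commute (RAAG.gen G u) (RAAG.gen G v) := by
  have h1 : PresentedGroup.mk (raagRels G) (FreeGroup.of u * FreeGroup.of v *
      (FreeGroup.of u)⁻¹ * (FreeGroup.of v)⁻¹) = 1 :=
    PresentedGroup.one_of_mem ⟨u, v, h, rfl⟩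
  simp only [map_mul, map_inv] at h1
  have h2 := mul_inv_eq_one.1 h1
  exact mul_inv_eq_iff_eq_mul.1 h2

/-- Universal property of a right-angled Artin group. -/
def raagLift {V : Type*} (G : SimpleGraph V) {K : Type*} [Group K] (f : V → K)
    (hf : ∀ u v, G.Adj u v → Commute (f u) (f v)) : RAAG G →* K :=
  PresentedGroup.toGroup (f := f) (by
    rintro r ⟨u, v, h, rfl⟩
    simp only [map_mul, map_inv, FreeGroup.lift_apply_of]
    rw [(hf u v h).eq]
    group)

theorem raagLift_gen {V : Type*} (G : SimpleGraph V) {K : Type*} [Group K] (f : V → K)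
    (hf : ∀ u v, G.Adj u v → Commute (f u) (f v)) (v : V) :
    raagLift G f hf (RAAG.gen G v) = f v :=
  PresentedGroup.toGroup.of _

theorem raag_ext {V : Type*} (G : SimpleGraph V) {K : Type*} [Group K] {f g : RAAG G →* K}
    (h : ∀ v, f (RAAG.gen G v) = g (RAAG.gen G v)) : f = g :=
  PresentedGroup.ext h

section HNN

variable {A : Type*} [Group A] (N : Subgroup A) [N.Normal]

/-- The endomorphism fixing `A` and conjugating the stable letter by `u`. -/
def hnnTwist (u : A) : HNNExtension A N N (MulEquiv.refl N) →*
    HNNExtension A N N (MulEquiv.refl N) :=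
  HNNExtension.lift HNNExtension.of
    ((HNNExtension.of u)⁻¹ * HNNExtension.t * HNNExtension.of u) (by
      intro a
      have hm : u * a * u⁻¹ ∈ N := Subgroup.Normal.conj_mem inferInstance _ a.2 u
      have h := HNNExtension.t_mul_of (φ := MulEquiv.refl N) ⟨u * a * u⁻¹, hm⟩
      simp only [MulEquiv.refl_apply, map_mul, map_inv] at h ⊢
      have h2 := congrArg (fun z => (HNNExtension.of u)⁻¹ * z * HNNExtension.of u) h
      simp only [mul_assoc, inv_mul_cancel_left, inv_mul_cancel, mul_one] at h2 ⊢
      exact h2)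

theorem hnnTwist_of (u g : A) :
    hnnTwist N u (HNNExtension.of g) = HNNExtension.of g := by
  simp [hnnTwist]

theorem hnnTwist_t (u : A) :
    hnnTwist N u HNNExtension.t =
      (HNNExtension.of u)⁻¹ * HNNExtension.t * HNNExtension.of u := by
  simp [hnnTwist]

theorem hnnTwist_comp (u v : A) (h : u * v = 1) :
    (hnnTwist N u).comp (hnnTwist N v) = MonoidHom.id _ := by
  obtain rfl := eq_inv_of_mul_eq_one_right h
  apply HNNExtension.hom_ext
  · ext g
    simp [hnnTwist_of]
  · simp [hnnTwist_of, hnnTwist_t, mul_assoc]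

/-- The twist as an automorphism. -/
def hnnTwistAut (u : A) : MulAut (HNNExtension A N N (MulEquiv.refl N)) :=
  MonoidHom.toMulEquiv (hnnTwist N u) (hnnTwist N u⁻¹)
    (hnnTwist_comp N _ _ (by simp)) (hnnTwist_comp N _ _ (by simp))

theorem hnnTwistAut_apply (u : A) (x) : hnnTwistAut N u x = hnnTwist N u x := rfl

end HNN

theorem stmt_10 (ℓ : A_L →* Multiplicative ℤ)
    (hℓ : ∀ i : Fin 4, ℓ (RAAG.gen L i) = Multiplicative.ofAdd 1)
    (ℓ₀ : RAAG G₀ →* Multiplicative ℤ)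
    (hℓ₀ : ∀ i : Fin 6, ℓ₀ (RAAG.gen G₀ i) = Multiplicative.ofAdd 1) :
    Nonempty (ℓ₀.ker ≃* HNNExtension A_L ℓ.ker ℓ.ker (MulEquiv.refl ℓ.ker)) := by
  -- the inclusion of `A_L`
  let j : Fin 4 → Fin 6 := fun i => i.castSucc.castSucc
  have hj : ∀ u v, L.Adj u v → G₀.Adj (j u) (j v) := by
    intro u v h
    rw [SimpleGraph.pathGraph_adj] at h
    simp only [G₀, SimpleGraph.fromRel_adj, j]
    revert u v
    decide
  have h4 : ∀ u, G₀.Adj 4 (j u) := by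
    intro u
    simp only [G₀, SimpleGraph.fromRel_adj, j]
    revert u
    decide
  have h5 : ∀ u, G₀.Adj 5 (j u) := by
    intro u
    simp only [G₀, SimpleGraph.fromRel_adj, j]
    revert u
    decide
  let ι : A_L →* RAAG G₀ := raagLift L (fun i => RAAG.gen G₀ (j i))
    (fun u v h => raag_comm G₀ (hj u v h))
  have ι_gen : ∀ i, ι (RAAG.gen L i) = RAAG.gen G₀ (j i) := fun i => raagLift_gen _ _ _ i
  set p := RAAG.gen G₀ 4 with hp
  set q := RAAG.gen G₀ 5 with hq
  have comm_ι : ∀ c : RAAG G₀, (∀ i, Commute c (RAAG.gen G₀ (j i))) → ∀ g, Commute c (ι g) := by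
    intro c hc g
    have : (MulAut.conj c).toMonoidHom.comp ι = ι := by
      apply raag_ext
      intro v
      simp only [MonoidHom.comp_apply, ι_gen]
      simp [(hc v).eq]
    have h := DFunLike.congr_fun this g
    simp at h
    exact mul_inv_eq_iff_eq_mul.1 h
  have comm_p : ∀ g, Commute p (ι g) := comm_ι p (fun i => raag_comm _ (h4 i))
  have comm_q : ∀ g, Commute q (ι g) := comm_ι q (fun i => raag_comm _ (h5 i))
  -- the map `A_L → Γ₀`, `g ↦ g p^{-ℓ g}`
  let f₀ : A_L →* RAAG G₀ :=
    { toFun := fun g => ι g * p ^ (-(toAdd (ℓ g)))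
      map_one' := by simp
      map_mul' := by
        intro a b
        have hc := ((comm_p b).zpow_left (-(toAdd (ℓ a)))).eq
        rw [map_mul, map_mul, toAdd_mul, neg_add, zpow_add]
        rw [mul_assoc (ι a) (p ^ _), ← mul_assoc (p ^ _) (ι b), hc]
        simp only [mul_assoc] }
  have f₀_apply : ∀ g, f₀ g = ι g * p ^ (-(toAdd (ℓ g))) := fun g => rfl
  let f : HNNExtension A_L ℓ.ker ℓ.ker (MulEquiv.refl ℓ.ker) →* RAAG G₀ :=
    HNNExtension.lift f₀ (p⁻¹ * q) (by
      intro a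
      have ha : ℓ a = 1 := a.2
      have : f₀ a = ι a := by simp [f₀_apply, ha]
      simp only [MulEquiv.refl_apply, this]
      exact ((comm_p a).inv_left.mul_left (comm_q a)).eq)
  have f_of : ∀ g, f (HNNExtension.of g) = f₀ g := fun g => HNNExtension.lift_of _ _ _ g
  have f_t : f HNNExtension.t = p⁻¹ * q := HNNExtension.lift_t _ _ _
  -- the automorphism
  let u : A_L := RAAG.gen L 0
  let α := hnnTwistAut ℓ.ker u
  have α_of : ∀ g, α (HNNExtension.of g) = HNNExtension.of g := fun g => hnnTwist_of ℓ.ker u g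
  have α_t : ∀ g, ℓ g = ofAdd 1 → α HNNExtension.t =
      (HNNExtension.of g)⁻¹ * HNNExtension.t * HNNExtension.of g := by
    intro g hg
    have h1 : α HNNExtension.t =
      (HNNExtension.of u)⁻¹ * HNNExtension.t * HNNExtension.of u := hnnTwist_t ℓ.ker u
    have hm : g * u⁻¹ ∈ ℓ.ker := by
      rw [MonoidHom.mem_ker, map_mul, map_inv, hg, hℓ 0, mul_inv_cancel]
    have h := HNNExtension.t_mul_of (φ := MulEquiv.refl ℓ.ker) ⟨g * u⁻¹, hm⟩
    simp only [MulEquiv.refl_apply, map_mul, map_inv] at h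
    have h2 := congrArg (fun z => (HNNExtension.of g)⁻¹ * z * HNNExtension.of u) h
    simp only [mul_assoc, inv_mul_cancel_left, inv_mul_cancel, mul_one] at h2
    rw [h1]
    simp only [mul_assoc]
    exact h2.symm
  -- conjugation by `p`
  have hconj : ∀ x, f (α x) = p * f x * p⁻¹ := by
    have : f.comp α.toMonoidHom = (MulAut.conj p).toMonoidHom.comp f := by
      apply HNNExtension.hom_ext
      · refine MonoidHom.ext fun g => ?_
        have hc := (((comm_p g).mul_right
          ((Commute.refl p).zpow_right (-(toAdd (ℓ g)))))).eq
        simp only [MonoidHom.comp_apply, MulEquiv.toMonoidHom_eq_coe, MonoidHom.coe_coe, α_of,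
          f_of, f₀_apply, MulAut.conj_apply]
        rw [hc, mul_inv_cancel_right]
      · simp only [MonoidHom.comp_apply, MulEquiv.toMonoidHom_eq_coe, MonoidHom.coe_coe,
          α_t u (hℓ 0), map_mul, map_inv,
          f_of, f₀_apply, MulAut.conj_apply, f_t]
        have hu : ℓ u = ofAdd 1 := hℓ 0
        rw [hu]
        have hp' := (comm_p u).eq
        have hq' := (comm_q u).eq
        simp only [toAdd_ofAdd, zpow_neg, zpow_one, mul_inv_rev, inv_inv]
        have e1 : p⁻¹ * q * (ι u * p⁻¹) = ι u * (p⁻¹ * q * p⁻¹) := by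
          have := ((comm_p u).inv_left.mul_left (comm_q u)).eq
          rw [← mul_assoc, this]
          simp only [mul_assoc]
        rw [mul_assoc, e1]
        simp only [mul_assoc, inv_mul_cancel_left]
    intro x
    exact DFunLike.congr_fun this x
  let act := zpowersHom (MulAut (HNNExtension A_L ℓ.ker ℓ.ker (MulEquiv.refl ℓ.ker))) α
  have act_one : act (ofAdd 1) = α := by simp [act]
  -- the map back
  let gg : Fin 6 →
    HNNExtension A_L ℓ.ker ℓ.ker (MulEquiv.refl ℓ.ker) ⋊[act] Multiplicative ℤ := ![⟨HNNExtension.of (RAAG.gen L 0), ofAdd 1⟩,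
    ⟨HNNExtension.of (RAAG.gen L 1), ofAdd 1⟩, ⟨HNNExtension.of (RAAG.gen L 2), ofAdd 1⟩,
    ⟨HNNExtension.of (RAAG.gen L 3), ofAdd 1⟩, ⟨1, ofAdd 1⟩, ⟨α HNNExtension.t, ofAdd 1⟩]
  have gg_j : ∀ i, gg (j i) = ⟨HNNExtension.of (RAAG.gen L i), ofAdd 1⟩ := by
    intro i; fin_cases i <;> rfl
  have gg_comm_uu : ∀ a b, L.Adj a b → Commute (gg (j a)) (gg (j b)) := by
    intro a b h
    rw [gg_j, gg_j]
    apply SemidirectProduct.ext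
    · simp only [SemidirectProduct.mul_left, act_one, α_of]
      rw [← map_mul, ← map_mul, (raag_comm L h).eq]
    · rfl
  have gg_comm_pu : ∀ a, Commute (gg 4) (gg (j a)) := by
    intro a
    rw [gg_j]
    apply SemidirectProduct.ext
    · change 1 * act (ofAdd 1) (HNNExtension.of _) = HNNExtension.of _ * act (ofAdd 1) 1
      simp [act_one, α_of]
    · rfl
  have gg_comm_qu : ∀ a, Commute (gg 5) (gg (j a)) := by
    intro a
    rw [gg_j]
    apply SemidirectProduct.ext
    · change α HNNExtension.t * act (ofAdd 1) (HNNExtension.of _) =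
        HNNExtension.of _ * act (ofAdd 1) (α HNNExtension.t)
      rw [act_one, α_of]
      rw [α_t _ (hℓ a)]
      simp only [map_mul, map_inv, α_of]
      rw [α_t _ (hℓ a)]
      simp only [mul_assoc, mul_inv_cancel_left]
    · rfl
  have cases6 : ∀ a b, G₀.Adj a b → (∃ i k, L.Adj i k ∧ a = j i ∧ b = j k) ∨
      (a = 4 ∧ ∃ i, b = j i) ∨ (a = 5 ∧ ∃ i, b = j i) ∨
      (b = 4 ∧ ∃ i, a = j i) ∨ (b = 5 ∧ ∃ i, a = j i) := by
    intro a b h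
    simp only [G₀, SimpleGraph.fromRel_adj] at h
    simp only [SimpleGraph.pathGraph_adj, j]
    revert a b
    decide
  let Ψ : RAAG G₀ →*
    (HNNExtension A_L ℓ.ker ℓ.ker (MulEquiv.refl ℓ.ker) ⋊[act] Multiplicative ℤ) := raagLift G₀ gg (by
    intro a b h
    rcases cases6 a b h with ⟨i, k, hik, rfl, rfl⟩ | ⟨rfl, i, rfl⟩ | ⟨rfl, i, rfl⟩ |
      ⟨rfl, i, rfl⟩ | ⟨rfl, i, rfl⟩
    · exact gg_comm_uu _ _ hik
    · exact gg_comm_pu _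
    · exact gg_comm_qu _
    · exact (gg_comm_pu _).symm
    · exact (gg_comm_qu _).symm)
  have Ψ_gen : ∀ i, Ψ (RAAG.gen G₀ i) = gg i := fun i => raagLift_gen _ _ _ i
  have Ψ_p : Ψ p = SemidirectProduct.inr (ofAdd 1) := Ψ_gen 4
  have Ψ_q : Ψ q = ⟨α HNNExtension.t, ofAdd 1⟩ := Ψ_gen 5
  have Ψ_q' : Ψ q = SemidirectProduct.inr (ofAdd 1) * SemidirectProduct.inl HNNExtension.t := by
    rw [Ψ_q]
    apply SemidirectProduct.ext
    · simp [act_one]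
    · simp
  have Ψ_f : Ψ.comp f = SemidirectProduct.inl := by
    apply HNNExtension.hom_ext
    · apply raag_ext
      intro v
      simp only [MonoidHom.comp_apply, f_of, f₀_apply, map_mul, ι_gen, hℓ, toAdd_ofAdd,
        zpow_neg, zpow_one, map_inv, Ψ_p, Ψ_gen, gg_j]
      rw [mul_inv_eq_iff_eq_mul]
      apply SemidirectProduct.ext <;> simp
    · simp only [MonoidHom.comp_apply, f_t, map_mul, map_inv, Ψ_p, Ψ_q', inv_mul_cancel_left]
  have f_inj : Function.Injective f := by
    have : Function.Injective (Ψ.comp f) := by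
      rw [Ψ_f]; exact SemidirectProduct.inl_injective
    exact Function.Injective.of_comp (f := Ψ) (by simpa using this)
  have hconjn : ∀ n : ℤ, ∀ x, f ((α ^ n) x) = p ^ n * f x * (p ^ n)⁻¹ := by
    intro n
    induction n using Int.induction_on with
    | zero => simp
    | succ n ih =>
      intro x
      rw [add_comm, zpow_add, zpow_add, zpow_one, zpow_one, MulAut.mul_apply, hconj, ih]
      group
    | pred n ih =>
      intro x
      have h := hconj (α⁻¹ x)
      rw [MulAut.apply_inv_self] at h
      rw [sub_eq_add_neg, zpow_add, zpow_add, zpow_neg_one, zpow_neg_one, MulAut.mul_apply, ih, h]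
      group
  let Φ : HNNExtension A_L ℓ.ker ℓ.ker (MulEquiv.refl ℓ.ker) ⋊[act] Multiplicative ℤ →* RAAG G₀ := SemidirectProduct.lift f (zpowersHom _ p) (by
    intro n
    refine MonoidHom.ext fun x => ?_
    exact hconjn (toAdd n) x)
  have Φ_mk : ∀ h n, Φ ⟨h, n⟩ = f h * p ^ (toAdd n) := fun h n => rfl
  have ΦΨ : Φ.comp Ψ = MonoidHom.id _ := by
    apply raag_ext
    intro v
    have hv : v = 4 ∨ v = 5 ∨ ∃ i, v = j i := by
      simp only [j]; revert v; decide
    simp only [MonoidHom.comp_apply, MonoidHom.id_apply]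
    rcases hv with rfl | rfl | ⟨i, rfl⟩
    · rw [← hp, Ψ_p]
      change f 1 * p ^ (1 : ℤ) = p
      simp
    · rw [← hq, Ψ_q, Φ_mk, hconj, f_t]
      simp
    · rw [Ψ_gen, gg_j, Φ_mk, f_of, f₀_apply, hℓ, ι_gen]
      simp
  have ℓ_f : ℓ₀.comp f = 1 := by
    apply HNNExtension.hom_ext
    · apply raag_ext
      intro v
      simp [f_of, f₀_apply, ι_gen, hℓ, hℓ₀, hp]
    · simp [f_t, hp, hq, hℓ₀]
  have f_mem : ∀ x, f x ∈ ℓ₀.ker := fun x => DFunLike.congr_fun ℓ_f x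
  have f_surj : ∀ y ∈ ℓ₀.ker, ∃ x, f x = y := by
    intro y hy
    have h := DFunLike.congr_fun ΦΨ y
    simp only [MonoidHom.comp_apply, MonoidHom.id_apply] at h
    have h' : f (Ψ y).left * p ^ (toAdd (Ψ y).right) = y := h
    have h2 := congrArg ℓ₀ h'
    rw [map_mul, (f_mem _ : ℓ₀ _ = 1), (hy : ℓ₀ y = 1), map_zpow, hℓ₀, one_mul,
      ← ofAdd_zsmul] at h2
    have h3 : toAdd (Ψ y).right = 0 := by
      have := congrArg toAdd h2
      simpa using this
    rw [h3, zpow_zero, mul_one] at h'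
    exact ⟨_, h'⟩
  refine ⟨(MulEquiv.ofBijective (f.codRestrict ℓ₀.ker f_mem) ⟨?_, ?_⟩).symm⟩
  · intro a b h
    exact f_inj (congrArg Subtype.val h)
  · rintro ⟨y, hy⟩
    obtain ⟨x, hx⟩ := f_surj y hy
    exact ⟨x, Subtype.ext hx⟩
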